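/- Fix n ≥ 1. (i) Let z be any real zero of Q_{2n}(·;ζ) (so |z| > 1) and set λ̂ := sqrt(z²−1)/z, which satisfies 0 < |λ̂| < 1. Define u ∈ ℝ^{n+1} by u_k := P_k^(0)(z;ζ)·P_n^(1)(−z;ζ) + P_k^(0)(−z;ζ)·P_n^(1)(z;ζ) for k = 0,…,n, and v ∈ ℝ^n by v_k := sqrt(z²−1)·(P_k^(1)(z;ζ)·P_n^(1)(−z;ζ) − P_k^(1)(−z;ζ)·P_n^(1)(z;ζ)) for k = 0,…,n−1. Then the vector y := (u,v) ∈ ℝ^{2n+1} is nonzero and satisfies the generalized eigenvalue equations λ̂·J_n^(0)·u = J_{n−1}ᵀ·v and λ̂·J_{n−1}^(1)·v = J_{n−1}·u, i.e. A_n¹·y = λ̂·A_n⁰·y. (ii) With u⁰ ∈ ℝ^{n+1} defined by u⁰_k := P_k^(0)(1;ζ)·P_{n+1}^(0)(−1;ζ) − P_k^(0)(−1;ζ)·P_{n+1}^(0)(1;ζ), the nonzero vector y⁰ := (u⁰, 0) satisfies A_n¹·y⁰ = 0. (iii) Consequently the matrix pair (A_n⁰, A_n¹) has 2n+1 real simple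 generalized eigenvalues: 0 together with the 2n values sqrt(z²−1)/z taken over the zeros z of Q_{2n}(·;ζ), each of absolute value strictly less than 1. -/

import Mathlib

open MeasureTheory Polynomial

noncomputable def besselK (n : ℕ) (ζ : ℝ) : ℝ :=
  ∫ t in Set.Ioi (0 : ℝ), Real.cosh ((n : ℝ) * t) * Real.exp (-ζ * Real.cosh t)

noncomputable def Gfun (ζ : ℝ) : ℝ := besselK 2 ζ / besselK 1 ζ

noncomputable def wgt (ℓ : ℕ) (ζ x : ℝ) : ℝ :=
  (x ^ 2 - 1) ^ ((ℓ : ℝ) - 1 / 2) * Real.exp (-ζ * x) / besselK 1 ζ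

noncomputable def jacobiSq (a b : ℕ → ℝ) (n : ℕ) :
    Matrix (Fin (n + 1)) (Fin (n + 1)) ℝ :=
  fun i j =>
    if (i : ℕ) = (j : ℕ) then b (i : ℕ)
    else if (i : ℕ) + 1 = (j : ℕ) ∨ (j : ℕ) + 1 = (i : ℕ) then
      a (min (i : ℕ) (j : ℕ))
    else 0

noncomputable def jacobiRect (p q r : ℕ → ℝ) (n : ℕ) :
    Matrix (Fin (n + 1)) (Fin (n + 2)) ℝ :=
  fun i j =>
    if (j : ℕ) = (i : ℕ) then p (i : ℕ)
    else if (j : ℕ) = (i : ℕ) + 1 then q (i : ℕ)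
    else if (j : ℕ) = (i : ℕ) + 2 then r ((i : ℕ) + 1)
    else 0

/-- `P` is a sequence of polynomials, one in each degree, orthonormal for the bilinear form
`(R, S) ↦ L (R * S)`. -/
structure IsOrthonormalSeq (L : ℝ[X] →ₗ[ℝ] ℝ) (P : ℕ → ℝ[X]) : Prop where
  natDegree_eq : ∀ n, (P n).natDegree = n
  orth : ∀ m n, L (P m * P n) = if m = n then 1 else 0

/-- A polynomial of degree at most `n` agrees up to lower degree with a multiple of `P n`. -/
theorem degree_sub_C_mul_lt {P : ℕ → ℝ[X]} (hdeg : ∀ n, (P n).natDegree = n)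
    (hne : ∀ n, P n ≠ 0) {n : ℕ} {R : ℝ[X]} (hR : R.degree < (n + 1 : ℕ)) :
    (R - C (R.coeff n / (P n).leadingCoeff) * P n).degree < (n : ℕ) := by
  have hlc : (P n).coeff n ≠ 0 := by
    have h := leadingCoeff_ne_zero.mpr (hne n)
    rwa [leadingCoeff, hdeg n] at h
  rw [degree_lt_iff_coeff_zero] at hR ⊢
  intro m hm
  rcases hm.eq_or_lt with rfl | hm
  · simp only [coeff_sub, coeff_C_mul, leadingCoeff, hdeg]
    field_simp
    ring
  · rw [coeff_sub, coeff_C_mul, hR m hm,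
      coeff_eq_zero_of_natDegree_lt (show (P n).natDegree < m by rw [hdeg n]; exact hm)]
    ring

namespace IsOrthonormalSeq

variable {L : ℝ[X] →ₗ[ℝ] ℝ} {P : ℕ → ℝ[X]}

theorem ne_zero (h : IsOrthonormalSeq L P) (n : ℕ) : P n ≠ 0 := by
  intro h0
  have := h.orth n n
  simp [h0] at this

theorem degree_eq (h : IsOrthonormalSeq L P) (n : ℕ) : (P n).degree = n := by
  rw [degree_eq_natDegree (h.ne_zero n), h.natDegree_eq]

theorem functional_C_mul (L : ℝ[X] →ₗ[ℝ] ℝ) (c : ℝ) (R : ℝ[X]) : L (C c * R) = c * L R := by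
  rw [← smul_eq_C_mul, map_smul, smul_eq_mul]

theorem expansion (h : IsOrthonormalSeq L P) (n : ℕ) :
    ∀ R : ℝ[X], R.degree < (n : ℕ) →
      R = ∑ k ∈ Finset.range n, C (L (R * P k)) * P k := by
  induction n with
  | zero =>
    intro R hR
    simpa [Polynomial.degree_lt_iff_coeff_zero, Polynomial.ext_iff] using hR
  | succ n ih =>
    intro R hR
    have hd := degree_sub_C_mul_lt h.natDegree_eq h.ne_zero hR
    set c := R.coeff n / (P n).leadingCoeff
    set S := R - C c * P n with hS
    have hRS : R = S + C c * P n := by rw [hS]; ring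
    have hmul : ∀ k, L (R * P k) = L (S * P k) + c * if n = k then 1 else 0 := by
      intro k
      rw [hRS, add_mul, map_add, mul_assoc, functional_C_mul, h.orth]
    have hSn : L (S * P n) = 0 := by
      rw [ih S hd, Finset.sum_mul, map_sum]
      refine Finset.sum_eq_zero fun k hk => ?_
      rw [mul_assoc, functional_C_mul, h.orth, if_neg (Finset.mem_range.mp hk).ne, mul_zero]
    rw [Finset.sum_range_succ, hmul n, hSn, if_pos rfl, zero_add, mul_one]
    conv_lhs => rw [hRS, ih S hd]
    congr 1
    refine Finset.sum_congr rfl fun k hk => ?_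
    rw [hmul k, if_neg (Finset.mem_range.mp hk).ne', mul_zero, add_zero]

theorem functional_eq_zero (h : IsOrthonormalSeq L P) {n : ℕ} {R : ℝ[X]}
    (hR : R.degree < (n : ℕ)) : L (R * P n) = 0 := by
  rw [h.expansion n R hR, Finset.sum_mul, map_sum]
  refine Finset.sum_eq_zero fun k hk => ?_
  rw [mul_assoc, functional_C_mul, h.orth, if_neg (Finset.mem_range.mp hk).ne, mul_zero]

theorem functional_eq_coeff_div (h : IsOrthonormalSeq L P) {n : ℕ} {R : ℝ[X]}
    (hR : R.degree < (n + 1 : ℕ)) : L (R * P n) = R.coeff n / (P n).leadingCoeff := by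
  have h0 := h.functional_eq_zero (degree_sub_C_mul_lt h.natDegree_eq h.ne_zero hR)
  rw [sub_mul, map_sub, mul_assoc, functional_C_mul, h.orth, if_pos rfl] at h0
  linarith

theorem eval_expansion (h : IsOrthonormalSeq L P) {n : ℕ} {R : ℝ[X]}
    (hR : R.degree < (n : ℕ)) (x : ℝ) :
    ∑ k ∈ Finset.range n, L (R * P k) * (P k).eval x = R.eval x := by
  conv_rhs => rw [h.expansion n R hR]
  simp [eval_finsetSum]

/-- A polynomial of degree at most `n` orthogonal to all lower degrees is a multiple of `P n`. -/
theorem eq_C_mul_of_functional_eq_zero (h : IsOrthonormalSeq L P) {n : ℕ} {R : ℝ[X]}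
    (hR : R.degree < (n + 1 : ℕ)) (h0 : ∀ k < n, L (R * P k) = 0) :
    R = C (L (R * P n)) * P n := by
  conv_lhs => rw [h.expansion (n + 1) R hR]
  rw [Finset.sum_range_succ, Finset.sum_eq_zero, zero_add]
  intro k hk
  rw [h0 k (Finset.mem_range.mp hk), C_0, zero_mul]

/-- The matrix of multiplication by `X` is tridiagonal. -/
theorem jacobiSq_eq (h : IsOrthonormalSeq L P) {a b : ℕ → ℝ}
    (ha : ∀ n, a n = (P n).leadingCoeff / (P (n + 1)).leadingCoeff)
    (hb : ∀ n, b n = L (X * P n * P n)) (n : ℕ) (i j : Fin (n + 1)) :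
    jacobiSq a b n i j = L (X * P i * P j) := by
  have hup : ∀ k, L (X * P k * P (k + 1)) = a k := by
    intro k
    rw [h.functional_eq_coeff_div, ha, coeff_X_mul]
    · simp only [leadingCoeff, h.natDegree_eq]
    rw [degree_mul, degree_X, h.degree_eq]
    norm_cast
    omega
  have hzero : ∀ k l : ℕ, k + 1 < l → L (X * P k * P l) = 0 := by
    intro k l hkl
    apply h.functional_eq_zero
    rw [degree_mul, degree_X, h.degree_eq]
    norm_cast
    omega
  have hsymm : ∀ k l : ℕ, L (X * P k * P l) = L (X * P l * P k) := fun k l => by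
    rw [mul_right_comm]
  unfold jacobiSq
  generalize (i : ℕ) = k
  generalize (j : ℕ) = l
  split_ifs with h1 h2
  · rw [hb, h1]
  · rcases h2 with rfl | rfl
    · rw [hup]; simp
    · rw [hsymm, hup]; simp
  · rcases lt_or_gt_of_ne h1 with h3 | h3
    · exact (hzero k l (by omega)).symm
    · rw [hsymm]; exact (hzero l k (by omega)).symm

end IsOrthonormalSeq

theorem degree_X_sq_sub_one : (X ^ 2 - 1 : ℝ[X]).degree = 2 := by
  simpa using degree_X_pow_sub_C (R := ℝ) (n := 2) two_pos 1

theorem leadingCoeff_X_sq_sub_one : (X ^ 2 - 1 : ℝ[X]).leadingCoeff = 1 := by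
  simp

/-- The connection matrix between the orthonormal polynomials for `L₀` and those for
`R ↦ L₀ ((X² - 1) R)` is banded. -/
theorem jacobiRect_eq {L₀ L₁ : ℝ[X] →ₗ[ℝ] ℝ} {P₀ P₁ : ℕ → ℝ[X]}
    (h₀ : IsOrthonormalSeq L₀ P₀) (h₁ : IsOrthonormalSeq L₁ P₁)
    (hL : ∀ R, L₁ R = L₀ ((X ^ 2 - 1) * R)) {p q r : ℕ → ℝ}
    (hp : ∀ n, p n = (P₀ n).leadingCoeff / (P₁ n).leadingCoeff)
    (hq : ∀ n, q n = L₁ (P₀ (n + 1) * P₁ n))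
    (hr : ∀ n, r (n + 1) = (P₁ n).leadingCoeff / (P₀ (n + 2)).leadingCoeff)
    (n : ℕ) (i : Fin (n + 1)) (j : Fin (n + 2)) :
    jacobiRect p q r n i j = L₁ (P₀ j * P₁ i) := by
  have hflip : ∀ k l : ℕ, L₁ (P₀ l * P₁ k) = L₀ ((X ^ 2 - 1) * P₁ k * P₀ l) := by
    intro k l
    rw [hL]
    congr 1
    ring
  have hdeg : ∀ k : ℕ, ((X ^ 2 - 1) * P₁ k).degree = ((k + 2 : ℕ) : WithBot ℕ) := by
    intro k
    rw [degree_mul, degree_X_sq_sub_one, h₁.degree_eq]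
    norm_cast
    rw [add_comm]
  unfold jacobiRect
  generalize (i : ℕ) = k
  generalize (j : ℕ) = l
  split_ifs with e1 e2 e3
  · subst e1
    rw [h₁.functional_eq_coeff_div, hp, leadingCoeff, h₀.natDegree_eq]
    rw [h₀.degree_eq]
    exact_mod_cast Nat.lt_succ_self _
  · subst e2
    exact hq k
  · subst e3
    rw [hflip, h₀.functional_eq_coeff_div, hr]
    · have : ((X ^ 2 - 1) * P₁ k).leadingCoeff = (P₁ k).leadingCoeff := by
        rw [leadingCoeff_mul, leadingCoeff_X_sq_sub_one, one_mul]
      rw [← this, leadingCoeff, natDegree_eq_of_degree_eq_some (hdeg k)]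
    · rw [hdeg]
      exact_mod_cast Nat.lt_succ_self _
  · by_cases h : l < k
    · refine (h₁.functional_eq_zero ?_).symm
      rw [h₀.degree_eq]
      exact_mod_cast h
    · rw [hflip]
      refine (h₀.functional_eq_zero ?_).symm
      rw [hdeg]
      norm_cast
      omega

theorem besselK_nonneg (n : ℕ) (ζ : ℝ) : 0 ≤ besselK n ζ :=
  setIntegral_nonneg measurableSet_Ioi fun _ _ =>
    mul_nonneg (Real.cosh_pos _).le (Real.exp_pos _).le

theorem wgt_nonneg (ℓ : ℕ) (ζ : ℝ) {x : ℝ} (hx : 1 < x) : 0 ≤ wgt ℓ ζ x :=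
  div_nonneg (mul_nonneg (Real.rpow_nonneg (by nlinarith) _) (Real.exp_pos _).le)
    (besselK_nonneg 1 ζ)

theorem wgt_pos (ℓ : ℕ) {ζ : ℝ} (hK : besselK 1 ζ ≠ 0) {x : ℝ} (hx : 1 < x) :
    0 < wgt ℓ ζ x :=
  div_pos (mul_pos (Real.rpow_pos_of_pos (by nlinarith) _) (Real.exp_pos _))
    ((besselK_nonneg 1 ζ).lt_of_ne' hK)

theorem wgt_one_eq (ζ : ℝ) {x : ℝ} (hx : 1 < x) : wgt 1 ζ x = (x ^ 2 - 1) * wgt 0 ζ x := by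
  have hpos : 0 < x ^ 2 - 1 := by nlinarith
  have h : (x ^ 2 - 1) ^ (((1 : ℕ) : ℝ) - 1 / 2)
      = (x ^ 2 - 1) * (x ^ 2 - 1) ^ (((0 : ℕ) : ℝ) - 1 / 2) := by
    rw [← Real.rpow_one_add' hpos.le (by norm_num)]
    norm_num
  unfold wgt
  rw [h]
  ring

theorem measurable_wgt (ℓ : ℕ) (ζ : ℝ) : Measurable (wgt ℓ ζ) := by
  unfold wgt
  fun_prop

theorem integrableOn_eval_mul_wgt {ℓ : ℕ} {ζ : ℝ} {P : ℕ → ℝ[X]}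
    (hdeg : ∀ n, (P n).natDegree = n)
    (horth : ∀ m n, (∫ x in Set.Ioi (1 : ℝ),
        (P m).eval x * (P n).eval x * wgt ℓ ζ x) = if m = n then (1 : ℝ) else 0) (R : ℝ[X]) :
    IntegrableOn (fun x => R.eval x * wgt ℓ ζ x) (Set.Ioi 1) := by
  have hne : ∀ n, P n ≠ 0 := by
    intro n h0
    have := horth n n
    simp [h0] at this
  have hsq : ∀ n, IntegrableOn (fun x => (P n).eval x * (P n).eval x * wgt ℓ ζ x)
      (Set.Ioi 1) := by
    intro n
    refine Integrable.of_integral_ne_zero ?_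
    rw [horth, if_pos rfl]
    exact one_ne_zero
  have hprod : ∀ m n, IntegrableOn (fun x => (P m).eval x * (P n).eval x * wgt ℓ ζ x)
      (Set.Ioi 1) := by
    intro m n
    refine Integrable.mono' ((hsq m).add (hsq n)) ?_ ?_
    · exact (((P m).continuous.measurable.mul (P n).continuous.measurable).mul
        (measurable_wgt ℓ ζ)).aestronglyMeasurable
    · refine (ae_restrict_iff' measurableSet_Ioi).mpr (.of_forall fun x hx => ?_)
      have hw := wgt_nonneg ℓ ζ (show 1 < x from hx)
      simp only [Pi.add_apply]
      rw [Real.norm_eq_abs, abs_mul, abs_of_nonneg hw, ← add_mul]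
      refine mul_le_mul_of_nonneg_right ?_ hw
      rw [abs_le]
      constructor <;>
        nlinarith [sq_nonneg ((P m).eval x + (P n).eval x),
          sq_nonneg ((P m).eval x - (P n).eval x), sq_nonneg ((P m).eval x),
          sq_nonneg ((P n).eval x)]
  have hP : ∀ n, IntegrableOn (fun x => (P n).eval x * wgt ℓ ζ x) (Set.Ioi 1) := by
    intro n
    have h0 := eq_C_of_natDegree_eq_zero (hdeg 0)
    have hc : (P 0).coeff 0 ≠ 0 := fun hc => hne 0 (by rw [h0, hc, C_0])
    have := (hprod n 0).const_mul ((P 0).coeff 0)⁻¹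
    refine this.congr (.of_forall fun x => ?_)
    have he : (P 0).eval x = (P 0).coeff 0 := by
      conv_lhs => rw [h0]
      simp
    simp only [he]
    field_simp
  have key : ∀ n : ℕ, ∀ R : ℝ[X], R.degree < (n : ℕ) →
      IntegrableOn (fun x => R.eval x * wgt ℓ ζ x) (Set.Ioi 1) := by
    intro n
    induction n with
    | zero =>
      intro R hR
      have : R = 0 := by
        simpa [Polynomial.degree_lt_iff_coeff_zero, Polynomial.ext_iff] using hR
      simp [this]
    | succ n ih =>
      intro R hR
      have h1 := ih _ (degree_sub_C_mul_lt hdeg hne hR)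
      refine (h1.add ((hP n).const_mul (R.coeff n / (P n).leadingCoeff))).congr
        (.of_forall fun x => ?_)
      simp only [Pi.add_apply, eval_sub, eval_mul, eval_C]
      ring
  refine key (R.natDegree + 1) R ?_
  exact lt_of_le_of_lt degree_le_natDegree (by exact_mod_cast Nat.lt_succ_self _)

/-- Integration of polynomials against the weight `wgt ℓ ζ`, as a linear functional. -/
noncomputable def wgtFunctional (ℓ : ℕ) (ζ : ℝ)
    (hint : ∀ R : ℝ[X], IntegrableOn (fun x => R.eval x * wgt ℓ ζ x) (Set.Ioi 1)) :
    ℝ[X] →ₗ[ℝ] ℝ where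
  toFun R := ∫ x in Set.Ioi (1 : ℝ), R.eval x * wgt ℓ ζ x
  map_add' R S := by
    simp only [eval_add, add_mul]
    exact integral_add (hint R) (hint S)
  map_smul' c R := by
    simp only [eval_smul, smul_eq_mul, mul_assoc, RingHom.id_apply]
    exact integral_const_mul _ _

theorem wgtFunctional_pos {ℓ : ℕ} {ζ : ℝ} (hK : besselK 1 ζ ≠ 0)
    (hint : ∀ R : ℝ[X], IntegrableOn (fun x => R.eval x * wgt ℓ ζ x) (Set.Ioi 1))
    {R : ℝ[X]} (hR0 : R ≠ 0) (hR : ∀ x, 1 < x → 0 ≤ R.eval x) :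
    0 < wgtFunctional ℓ ζ hint R := by
  change 0 < ∫ x in Set.Ioi (1 : ℝ), R.eval x * wgt ℓ ζ x
  rw [setIntegral_pos_iff_support_of_nonneg_ae
    ((ae_restrict_iff' measurableSet_Ioi).mpr
      (.of_forall fun x hx => mul_nonneg (hR x hx) (wgt_pos ℓ hK hx).le)) (hint R)]
  have hsub : Set.Ioi (1 : ℝ) \ (R.roots.toFinset : Set ℝ) ⊆
      (Function.support fun x => R.eval x * wgt ℓ ζ x) ∩ Set.Ioi 1 := by
    rintro x ⟨hx, hxr⟩
    refine ⟨mul_ne_zero (fun h => hxr ?_) (wgt_pos ℓ hK hx).ne', hx⟩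
    simpa [hR0] using h
  refine lt_of_lt_of_le ?_ (measure_mono hsub)
  rw [measure_sdiff_null (R.roots.toFinset.finite_toSet.measure_zero _)]
  simp

theorem neg_one_pow_mul_eval {n : ℕ} {c : ℝ} {t : ℕ → ℝ} {R : ℝ[X]}
    (hR : R = C c * ∏ i ∈ Finset.Icc 1 n, (X - C (t i))) (x : ℝ) :
    (-1) ^ n * R.eval x = c * ∏ i ∈ Finset.Icc 1 n, (t i - x) := by
  have h : ∀ i, t i - x = (-1) * (x - t i) := fun i => by ring
  simp only [h, Finset.prod_mul_distrib, Finset.prod_const, Nat.card_Icc, Nat.add_sub_cancel]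
  rw [hR, eval_mul, eval_C, eval_prod]
  simp only [eval_sub, eval_X, eval_C]
  ring

theorem neg_one_pow_mul_eval_pos {n : ℕ} {c : ℝ} (hc : 0 < c) {t : ℕ → ℝ} {R : ℝ[X]}
    (hR : R = C c * ∏ i ∈ Finset.Icc 1 n, (X - C (t i)))
    (ht : ∀ i, 1 ≤ i → i ≤ n → 1 < t i) {x : ℝ} (hx : x ≤ 1) :
    0 < (-1) ^ n * R.eval x := by
  rw [neg_one_pow_mul_eval hR]
  refine mul_pos hc (Finset.prod_pos fun i hi => ?_)
  rw [Finset.mem_Icc] at hi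
  linarith [ht i hi.1 hi.2]

theorem eval_ne_zero_of_le_one {n : ℕ} {c : ℝ} (hc : 0 < c) {t : ℕ → ℝ} {R : ℝ[X]}
    (hR : R = C c * ∏ i ∈ Finset.Icc 1 n, (X - C (t i)))
    (ht : ∀ i, 1 ≤ i → i ≤ n → 1 < t i) {x : ℝ} (hx : x ≤ 1) : R.eval x ≠ 0 := fun h =>
  (neg_one_pow_mul_eval_pos hc hR ht hx).ne' (by rw [h, mul_zero])

theorem eval_one_ne_eval_neg_one {n : ℕ} (hn : 1 ≤ n) {c : ℝ} (hc : 0 < c) {t : ℕ → ℝ}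
    {R : ℝ[X]} (hR : R = C c * ∏ i ∈ Finset.Icc 1 n, (X - C (t i)))
    (ht : ∀ i, 1 ≤ i → i ≤ n → 1 < t i) : R.eval 1 ≠ R.eval (-1) := by
  intro h
  have h1 := neg_one_pow_mul_eval hR 1
  rw [h, neg_one_pow_mul_eval hR (-1)] at h1
  refine absurd (mul_left_cancel₀ hc.ne' h1) (ne_of_gt ?_)
  refine Finset.prod_lt_prod_of_nonempty (fun i hi => ?_) (fun i _ => by linarith)
    (Finset.nonempty_Icc.mpr hn)
  rw [Finset.mem_Icc] at hi
  linarith [ht i hi.1 hi.2]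

/-- The polynomial with coefficient vector `u` in the sequence `P`. -/
noncomputable def combination (P : ℕ → ℝ[X]) {n : ℕ} (u : Fin n → ℝ) : ℝ[X] :=
  ∑ j : Fin n, C (u j) * P j

namespace IsOrthonormalSeq

variable {L : ℝ[X] →ₗ[ℝ] ℝ} {P : ℕ → ℝ[X]}

theorem sum_functional_mul (L : ℝ[X] →ₗ[ℝ] ℝ) (P : ℕ → ℝ[X]) {n : ℕ} (R : ℝ[X])
    (u : Fin n → ℝ) : ∑ j : Fin n, L (R * P j) * u j = L (R * combination P u) := by
  rw [combination, Finset.mul_sum, map_sum]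
  refine Finset.sum_congr rfl fun j _ => ?_
  rw [mul_left_comm, functional_C_mul, mul_comm]

theorem degree_combination_lt (h : IsOrthonormalSeq L P) {n : ℕ} (u : Fin n → ℝ) :
    (combination P u).degree < (n : ℕ) := by
  rw [combination, ← mem_degreeLT]
  refine Submodule.sum_mem _ fun j _ => ?_
  rw [← smul_eq_C_mul]
  refine Submodule.smul_mem _ _ (mem_degreeLT.mpr ?_)
  rw [h.degree_eq]
  exact_mod_cast j.isLt

theorem functional_combination_mul (h : IsOrthonormalSeq L P) {n : ℕ} (u : Fin n → ℝ)
    (k : Fin n) : L (combination P u * P k) = u k := by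
  rw [mul_comm, ← sum_functional_mul, Finset.sum_eq_single k]
  · rw [h.orth, if_pos rfl, one_mul]
  · intro j _ hj
    rw [h.orth, if_neg fun e => hj (Fin.ext e.symm), zero_mul]
  · simp

theorem combination_injective (h : IsOrthonormalSeq L P) {n : ℕ} :
    Function.Injective (combination P : (Fin n → ℝ) → ℝ[X]) := fun u v huv => by
  ext k
  rw [← h.functional_combination_mul u k, huv, h.functional_combination_mul]

end IsOrthonormalSeq

theorem combination_zero (P : ℕ → ℝ[X]) (n : ℕ) : combination P (0 : Fin n → ℝ) = 0 := by
  simp [combination]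

theorem combination_smul (P : ℕ → ℝ[X]) {n : ℕ} (c : ℝ) (u : Fin n → ℝ) :
    combination P (c • u) = C c * combination P u := by
  simp [combination, Finset.mul_sum, mul_assoc]

/-- The block eigenvalue equation splits into its two components. -/
theorem fromBlocks_mulVec_eq_smul_iff {m n : Type*} [Fintype m] [Fintype n]
    (S : Matrix m m ℝ) (T : Matrix n n ℝ) (B : Matrix n m ℝ) (lam : ℝ) (u : m → ℝ) (v : n → ℝ) :
    (Matrix.fromBlocks 0 B.transpose B 0).mulVec (Sum.elim u v)
        = lam • (Matrix.fromBlocks S 0 0 T).mulVec (Sum.elim u v) ↔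
      lam • S.mulVec u = B.transpose.mulVec v ∧ lam • T.mulVec v = B.mulVec u := by
  simp only [Matrix.fromBlocks_mulVec, Sum.elim_comp_inl, Sum.elim_comp_inr,
    Matrix.zero_mulVec, add_zero, zero_add, funext_iff, Sum.forall, Sum.elim_inl, Sum.elim_inr,
    Pi.smul_apply, smul_eq_mul]
  exact and_congr (forall_congr' fun _ => eq_comm) (forall_congr' fun _ => eq_comm)

section Pencil

variable {L₀ L₁ : ℝ[X] →ₗ[ℝ] ℝ} {P₀ P₁ : ℕ → ℝ[X]} {n : ℕ}
  {S : Matrix (Fin (n + 2)) (Fin (n + 2)) ℝ} {T : Matrix (Fin (n + 1)) (Fin (n + 1)) ℝ}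
  {B : Matrix (Fin (n + 1)) (Fin (n + 2)) ℝ}

/-- The residual polynomials of the eigenvalue equations are multiples of the first orthogonal
polynomials beyond the truncation. -/
theorem exists_residual (h₀ : IsOrthonormalSeq L₀ P₀) (h₁ : IsOrthonormalSeq L₁ P₁)
    (hL : ∀ R, L₁ R = L₀ ((X ^ 2 - 1) * R))
    (hS : ∀ i j, S i j = L₀ (X * P₀ i * P₀ j)) (hT : ∀ i j, T i j = L₁ (X * P₁ i * P₁ j))
    (hB : ∀ i j, B i j = L₁ (P₀ j * P₁ i)) {lam : ℝ} {u : Fin (n + 2) → ℝ}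
    {v : Fin (n + 1) → ℝ} (hu : lam • S.mulVec u = B.transpose.mulVec v)
    (hv : lam • T.mulVec v = B.mulVec u) :
    ∃ c d : ℝ,
      C lam * (X * combination P₀ u) - (X ^ 2 - 1) * combination P₁ v = C c * P₀ (n + 2) ∧
      C lam * (X * combination P₁ v) - combination P₀ u = C d * P₁ (n + 1) := by
  have hdU := h₀.degree_combination_lt u
  have hdV := h₁.degree_combination_lt v
  refine ⟨_, _, h₀.eq_C_mul_of_functional_eq_zero ?_ fun k hk => ?_,
    h₁.eq_C_mul_of_functional_eq_zero ?_ fun k hk => ?_⟩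
  · rw [degree_lt_iff_coeff_zero] at hdU hdV ⊢
    intro m hm
    obtain ⟨m, rfl⟩ : ∃ l, m = l + 2 := ⟨m - 2, by omega⟩
    have e : (X ^ 2 - 1) * combination P₁ v
        = X ^ 2 * combination P₁ v - combination P₁ v := by ring
    rw [e, coeff_sub, coeff_sub, coeff_C_mul, coeff_X_mul, coeff_X_pow_mul,
      hdU _ (by omega), hdV _ (by omega), hdV _ (by omega)]
    ring
  · have := congrFun hu ⟨k, hk⟩
    simp only [Pi.smul_apply, smul_eq_mul, Matrix.mulVec, dotProduct, Matrix.transpose_apply,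
      hS, hB, IsOrthonormalSeq.sum_functional_mul] at this
    rw [hL, mul_right_comm, mul_comm (P₀ k), ← mul_assoc] at this
    rw [sub_mul, map_sub, mul_assoc, IsOrthonormalSeq.functional_C_mul, this, sub_self]
  · rw [degree_lt_iff_coeff_zero] at hdU hdV ⊢
    intro m hm
    obtain ⟨m, rfl⟩ : ∃ l, m = l + 1 := ⟨m - 1, by omega⟩
    rw [coeff_sub, coeff_C_mul, coeff_X_mul, hdU _ (by omega), hdV _ (by omega)]
    ring
  · have := congrFun hv ⟨k, hk⟩
    simp only [Pi.smul_apply, smul_eq_mul, Matrix.mulVec, dotProduct,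
      hT, hB, mul_comm (P₀ _) (P₁ k), IsOrthonormalSeq.sum_functional_mul] at this
    rw [mul_right_comm, mul_comm (P₁ k)] at this
    rw [sub_mul, map_sub, mul_assoc, IsOrthonormalSeq.functional_C_mul, this, sub_self]

/-- The explicit eigenvector belonging to a zero of
`x ↦ P₀ (n + 2) x * P₁ (n + 1) (-x) + P₀ (n + 2) (-x) * P₁ (n + 1) x`. -/
theorem explicit_eigenvector (h₀ : IsOrthonormalSeq L₀ P₀) (h₁ : IsOrthonormalSeq L₁ P₁)
    (hL : ∀ R, L₁ R = L₀ ((X ^ 2 - 1) * R))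
    (hS : ∀ i j, S i j = L₀ (X * P₀ i * P₀ j)) (hT : ∀ i j, T i j = L₁ (X * P₁ i * P₁ j))
    (hB : ∀ i j, B i j = L₁ (P₀ j * P₁ i)) {z s lam : ℝ} (hs : s ^ 2 = z ^ 2 - 1)
    (hlam : lam * z = s)
    (hz : (P₀ (n + 2)).eval z * (P₁ (n + 1)).eval (-z)
      + (P₀ (n + 2)).eval (-z) * (P₁ (n + 1)).eval z = 0)
    {u : Fin (n + 2) → ℝ} (hu : ∀ k : Fin (n + 2), u k =
      (P₀ k).eval z * (P₁ (n + 1)).eval (-z) + (P₀ k).eval (-z) * (P₁ (n + 1)).eval z)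
    {v : Fin (n + 1) → ℝ} (hv : ∀ k : Fin (n + 1), v k = s *
      ((P₁ k).eval z * (P₁ (n + 1)).eval (-z) - (P₁ k).eval (-z) * (P₁ (n + 1)).eval z)) :
    lam • S.mulVec u = B.transpose.mulVec v ∧ lam • T.mulVec v = B.mulVec u := by
  set α := (P₁ (n + 1)).eval (-z)
  set β := (P₁ (n + 1)).eval z
  have hdeg : ∀ {R : ℝ[X]} {k m : ℕ}, R.degree = k → k < m → R.degree < (m : ℕ) := by
    intro R k m h hkm
    rw [h]
    exact_mod_cast hkm
  have hdegX : ∀ {R : ℝ[X]} {k : ℕ}, R.degree = k → (X * R).degree = ((k + 1 : ℕ) : WithBot ℕ) := by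
    intro R k h
    rw [degree_mul, degree_X, h]
    norm_cast
    rw [add_comm]
  have hdegX2 : ∀ {R : ℝ[X]} {k : ℕ}, R.degree = k →
      ((X ^ 2 - 1) * R).degree = ((k + 2 : ℕ) : WithBot ℕ) := by
    intro R k h
    rw [degree_mul, degree_X_sq_sub_one, h]
    norm_cast
    rw [add_comm]
  have hsum₀ : ∀ (R : ℝ[X]), R.degree < (n + 3 : ℕ) →
      ∑ j : Fin (n + 2), L₀ (R * P₀ j) * u j = R.eval z * α + R.eval (-z) * β := by
    intro R hR
    have h1 := h₀.eval_expansion hR z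
    have h2 := h₀.eval_expansion hR (-z)
    rw [Finset.sum_range_succ] at h1 h2
    simp only [hu]
    rw [Fin.sum_univ_eq_sum_range (fun j => L₀ (R * P₀ j) *
      ((P₀ j).eval z * α + (P₀ j).eval (-z) * β))]
    simp only [mul_add, Finset.sum_add_distrib, ← mul_assoc, ← Finset.sum_mul]
    linear_combination α * h1 + β * h2 - L₀ (R * P₀ (n + 2)) * hz
  have hsum₁ : ∀ (R : ℝ[X]), R.degree < (n + 2 : ℕ) →
      ∑ j : Fin (n + 1), L₁ (R * P₁ j) * v j = s * (R.eval z * α - R.eval (-z) * β) := by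
    intro R hR
    have h1 := h₁.eval_expansion hR z
    have h2 := h₁.eval_expansion hR (-z)
    rw [Finset.sum_range_succ] at h1 h2
    simp only [hv]
    rw [Fin.sum_univ_eq_sum_range (fun j => L₁ (R * P₁ j) *
      (s * ((P₁ j).eval z * α - (P₁ j).eval (-z) * β)))]
    simp only [mul_left_comm _ s, ← Finset.mul_sum]
    simp only [mul_sub, Finset.sum_sub_distrib, ← mul_assoc, ← Finset.sum_mul]
    linear_combination s * α * h1 - s * β * h2
  constructor
  · ext k
    have hk : (k : ℕ) < n + 2 := k.isLt
    simp only [Pi.smul_apply, smul_eq_mul, Matrix.mulVec, dotProduct, Matrix.transpose_apply,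
      hS, hB]
    rw [hsum₀ _ (hdeg (hdegX (h₀.degree_eq k)) (by omega)),
      hsum₁ _ (hdeg (h₀.degree_eq k) hk)]
    simp only [eval_mul, eval_X]
    linear_combination ((P₀ k).eval z * α - (P₀ k).eval (-z) * β) * hlam
  · ext k
    have hk : (k : ℕ) < n + 1 := k.isLt
    have e : ∀ j : Fin (n + 2), L₁ (P₀ j * P₁ k) = L₀ ((X ^ 2 - 1) * P₁ k * P₀ j) := by
      intro j
      rw [hL]
      congr 1
      ring
    simp only [Pi.smul_apply, smul_eq_mul, Matrix.mulVec, dotProduct, hT, hB, e]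
    rw [hsum₁ _ (hdeg (hdegX (h₁.degree_eq k)) (by omega)),
      hsum₀ _ (hdeg (hdegX2 (h₁.degree_eq k)) (by omega))]
    simp only [eval_mul, eval_X, eval_sub, eval_pow, eval_one]
    linear_combination (s * ((P₁ k).eval z * α + (P₁ k).eval (-z) * β)) * hlam
      + ((P₁ k).eval z * α + (P₁ k).eval (-z) * β) * hs

/-- The explicit kernel vector of the rectangular connection matrix. -/
theorem explicit_kernel_vector (h₀ : IsOrthonormalSeq L₀ P₀) (h₁ : IsOrthonormalSeq L₁ P₁)
    (hL : ∀ R, L₁ R = L₀ ((X ^ 2 - 1) * R)) (hB : ∀ i j, B i j = L₁ (P₀ j * P₁ i))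
    {u : Fin (n + 2) → ℝ} (hu : ∀ k : Fin (n + 2), u k =
      (P₀ k).eval 1 * (P₀ (n + 2)).eval (-1) - (P₀ k).eval (-1) * (P₀ (n + 2)).eval 1) :
    B.mulVec u = 0 := by
  ext k
  have hR : ((X ^ 2 - 1) * P₁ k).degree < ((n + 3 : ℕ) : WithBot ℕ) := by
    rw [degree_mul, degree_X_sq_sub_one, h₁.degree_eq]
    norm_cast
    omega
  have e : ∀ j : Fin (n + 2), L₁ (P₀ j * P₁ k) = L₀ ((X ^ 2 - 1) * P₁ k * P₀ j) := by
    intro j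
    rw [hL]
    congr 1
    ring
  have h1 := h₀.eval_expansion hR 1
  have h2 := h₀.eval_expansion hR (-1)
  rw [Finset.sum_range_succ] at h1 h2
  simp only [eval_mul, eval_X, eval_sub, eval_pow, eval_one] at h1 h2
  simp only [Matrix.mulVec, dotProduct, hB, e, hu, Pi.zero_apply]
  rw [Fin.sum_univ_eq_sum_range (fun j => L₀ ((X ^ 2 - 1) * P₁ k * P₀ j) *
    ((P₀ j).eval 1 * (P₀ (n + 2)).eval (-1) - (P₀ j).eval (-1) * (P₀ (n + 2)).eval 1))]
  simp only [mul_sub, Finset.sum_sub_distrib, ← mul_assoc, ← Finset.sum_mul]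
  linear_combination (P₀ (n + 2)).eval (-1) * h1 - (P₀ (n + 2)).eval 1 * h2

end Pencil

/-- Strict positivity of the form `λ x (U² + (x² - 1) V²) - 2 (x² - 1) U V` for `x > 1`. -/
theorem pencil_form_nonneg {lam x a b : ℝ} (hlam : 1 ≤ lam) (hx : 1 < x) :
    0 ≤ lam * (x * (a ^ 2 + (x ^ 2 - 1) * b ^ 2)) - 2 * ((x ^ 2 - 1) * (a * b)) ∧
    (lam * (x * (a ^ 2 + (x ^ 2 - 1) * b ^ 2)) - 2 * ((x ^ 2 - 1) * (a * b)) = 0 →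
      a = 0 ∧ b = 0) := by
  have hpos : 0 < x ^ 2 - 1 := by nlinarith
  set s := √(x ^ 2 - 1) with hs
  have hs2 : s ^ 2 = x ^ 2 - 1 := Real.sq_sqrt hpos.le
  have hs0 : 0 < s := Real.sqrt_pos.mpr hpos
  have hsx : s < x := by nlinarith
  rw [← hs2]
  have hq : 0 ≤ x * (a ^ 2 + s ^ 2 * b ^ 2) := by positivity
  have h1 : (x - s) * (a ^ 2 + s ^ 2 * b ^ 2) ≤
      lam * (x * (a ^ 2 + s ^ 2 * b ^ 2)) - 2 * (s ^ 2 * (a * b)) := by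
    nlinarith [mul_nonneg (sub_nonneg.mpr hlam) hq, mul_nonneg hs0.le (sq_nonneg (a - s * b))]
  have hxs : 0 < x - s := sub_pos.mpr hsx
  refine ⟨le_trans (by positivity) h1, fun h0 => ?_⟩
  have h2 : a ^ 2 + s ^ 2 * b ^ 2 ≤ 0 := by
    by_contra! h
    nlinarith [mul_pos hxs h]
  constructor
  · exact pow_eq_zero_iff two_ne_zero |>.mp (by nlinarith [sq_nonneg a, sq_nonneg (s * b)])
  · have h3 : (s * b) ^ 2 = 0 := by nlinarith [sq_nonneg a, sq_nonneg (s * b)]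
    exact (mul_eq_zero.mp (pow_eq_zero_iff two_ne_zero |>.mp h3)).resolve_left hs0.ne'

theorem eq_zero_of_eval_eq_zero_of_one_lt {R : ℝ[X]} (h : ∀ x, 1 < x → R.eval x = 0) :
    R = 0 :=
  eq_zero_of_infinite_isRoot R ((Set.Ioi_infinite (1 : ℝ)).mono fun x hx => h x hx)

section Residual

variable {L₀ L₁ : ℝ[X] →ₗ[ℝ] ℝ} {P₀ P₁ : ℕ → ℝ[X]} {n : ℕ} {U V : ℝ[X]} {lam c d : ℝ}

theorem eq_zero_of_residual_of_one_le (h₀ : IsOrthonormalSeq L₀ P₀)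
    (h₁ : IsOrthonormalSeq L₁ P₁) (hL : ∀ R, L₁ R = L₀ ((X ^ 2 - 1) * R))
    (hpos : ∀ R : ℝ[X], R ≠ 0 → (∀ x, 1 < x → 0 ≤ R.eval x) → 0 < L₀ R)
    (hU : U.degree < (n + 2 : ℕ)) (hV : V.degree < (n + 1 : ℕ))
    (hUV : C lam * (X * U) - (X ^ 2 - 1) * V = C c * P₀ (n + 2))
    (hVU : C lam * (X * V) - U = C d * P₁ (n + 1)) (hlam : 1 ≤ lam) : U = 0 ∧ V = 0 := by
  set G := C lam * (X * (U ^ 2 + (X ^ 2 - 1) * V ^ 2)) - 2 * ((X ^ 2 - 1) * (U * V)) with hG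
  have hGeval : ∀ x, G.eval x = lam * (x * (U.eval x ^ 2 + (x ^ 2 - 1) * V.eval x ^ 2))
      - 2 * ((x ^ 2 - 1) * (U.eval x * V.eval x)) := by
    intro x
    simp [hG]
  have hLG : L₀ G = 0 := by
    have e : G = C c * (U * P₀ (n + 2)) + (X ^ 2 - 1) * (C d * (V * P₁ (n + 1))) := by
      linear_combination U * hUV + (X ^ 2 - 1) * V * hVU
    rw [e, map_add, ← hL, IsOrthonormalSeq.functional_C_mul, IsOrthonormalSeq.functional_C_mul,
      h₀.functional_eq_zero hU, h₁.functional_eq_zero hV]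
    ring
  have hG0 : G = 0 := by
    by_contra hne
    refine (hpos G hne fun x hx => ?_).ne' hLG
    rw [hGeval]
    exact (pencil_form_nonneg hlam hx).1
  have hzero : ∀ x, 1 < x → U.eval x = 0 ∧ V.eval x = 0 := by
    intro x hx
    refine (pencil_form_nonneg hlam hx).2 ?_
    rw [← hGeval, hG0, eval_zero]
  exact ⟨eq_zero_of_eval_eq_zero_of_one_lt fun x hx => (hzero x hx).1,
    eq_zero_of_eval_eq_zero_of_one_lt fun x hx => (hzero x hx).2⟩

/-- Generalized eigenvalues of the pencil lie strictly between `-1` and `1`. -/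
theorem eq_zero_of_residual_of_one_le_abs (h₀ : IsOrthonormalSeq L₀ P₀)
    (h₁ : IsOrthonormalSeq L₁ P₁) (hL : ∀ R, L₁ R = L₀ ((X ^ 2 - 1) * R))
    (hpos : ∀ R : ℝ[X], R ≠ 0 → (∀ x, 1 < x → 0 ≤ R.eval x) → 0 < L₀ R)
    (hU : U.degree < (n + 2 : ℕ)) (hV : V.degree < (n + 1 : ℕ))
    (hUV : C lam * (X * U) - (X ^ 2 - 1) * V = C c * P₀ (n + 2))
    (hVU : C lam * (X * V) - U = C d * P₁ (n + 1)) (hlam : 1 ≤ |lam|) : U = 0 ∧ V = 0 := by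
  rcases le_abs.mp hlam with h | h
  · exact eq_zero_of_residual_of_one_le h₀ h₁ hL hpos hU hV hUV hVU h
  · have := eq_zero_of_residual_of_one_le (V := -V) (lam := -lam) (c := -c) (d := d)
      h₀ h₁ hL hpos hU (by rwa [degree_neg])
      (by rw [C_neg, C_neg]; linear_combination -hUV)
      (by rw [C_neg]; linear_combination hVU) h
    simpa using this

variable {A D : ℝ[X]}

theorem residual_eval (hUV : C lam * (X * U) - (X ^ 2 - 1) * V = C c * A)
    (hVU : C lam * (X * V) - U = C d * D) {w : ℝ} (hw : (1 - lam ^ 2) * w ^ 2 = 1) :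
    c * A.eval w = -(lam * d * (w * D.eval w)) := by
  have h1 := congrArg (eval w) hUV
  have h2 := congrArg (eval w) hVU
  simp only [eval_sub, eval_mul, eval_C, eval_X, eval_pow, eval_one] at h1 h2
  linear_combination -h1 - lam * w * h2 - V.eval w * hw

theorem eq_zero_of_residual_zero (hUV : C lam * (X * U) - (X ^ 2 - 1) * V = 0)
    (hVU : C lam * (X * V) - U = 0) : U = 0 ∧ V = 0 := by
  have hprod : ((C lam ^ 2 - 1) * X ^ 2 + 1) * V = 0 := by
    linear_combination hUV + C lam * X * hVU
  have hV : V = 0 := by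
    refine (mul_eq_zero.mp hprod).resolve_left fun h => ?_
    have := congrArg (eval 0) h
    simp at this
  rw [hV] at hVU
  exact ⟨by linear_combination -hVU, hV⟩

/-- A nontrivial solution of the residual equations exists only at the zeros of
`x ↦ A x * D (-x) + A (-x) * D x`. -/
theorem eval_eq_zero_of_residual (hUV : C lam * (X * U) - (X ^ 2 - 1) * V = C c * A)
    (hVU : C lam * (X * V) - U = C d * D) (hne : ¬(U = 0 ∧ V = 0)) (hlam : lam ≠ 0)
    {w : ℝ} (hw0 : w ≠ 0) (hw : (1 - lam ^ 2) * w ^ 2 = 1) (hD : D.eval (-w) ≠ 0) :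
    A.eval w * D.eval (-w) + A.eval (-w) * D.eval w = 0 := by
  have h1 := residual_eval hUV hVU hw
  have h2 := residual_eval hUV hVU (w := -w) (by rw [neg_sq]; exact hw)
  have hc : c * (A.eval w * D.eval (-w) + A.eval (-w) * D.eval w) = 0 := by
    linear_combination D.eval (-w) * h1 + D.eval w * h2
  refine (mul_eq_zero.mp hc).resolve_left fun hc0 => hne ?_
  rw [hc0, zero_mul] at h2
  have hd : d = 0 := by
    simpa [hlam, hw0, hD] using h2.symm
  rw [hc0, C_0, zero_mul] at hUV
  rw [hd, C_0, zero_mul] at hVU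
  exact eq_zero_of_residual_zero hUV hVU

/-- The solution space of the residual equations is at most one-dimensional. -/
theorem residual_proportional {U' V' : ℝ[X]} {c' d' : ℝ}
    (hUV : C lam * (X * U) - (X ^ 2 - 1) * V = C c * A)
    (hVU : C lam * (X * V) - U = C d * D)
    (hUV' : C lam * (X * U') - (X ^ 2 - 1) * V' = C c' * A)
    (hVU' : C lam * (X * V') - U' = C d' * D) (hne : ¬(U = 0 ∧ V = 0))
    {w : ℝ} (hw : (1 - lam ^ 2) * w ^ 2 = 1) (hA : A.eval w ≠ 0) :
    ∃ k : ℝ, U' = C k * U ∧ V' = C k * V := by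
  have h1 := residual_eval hUV hVU hw
  have h2 := residual_eval hUV' hVU' hw
  have hd : d ≠ 0 := by
    intro hd
    rw [hd, mul_zero, zero_mul, neg_zero] at h1
    have hc := (mul_eq_zero.mp h1).resolve_right hA
    rw [hc, C_0, zero_mul] at hUV
    rw [hd, C_0, zero_mul] at hVU
    exact hne (eq_zero_of_residual_zero hUV hVU)
  have hd' : d' = d' / d * d := by field_simp
  have hc' : c' = d' / d * c := by
    refine mul_right_cancel₀ hA ?_
    linear_combination h2 - d' / d * h1 - lam * w * D.eval w * hd'
  set k := d' / d
  rw [hc', C_mul] at hUV'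
  rw [hd', C_mul] at hVU'
  obtain ⟨hU0, hV0⟩ := eq_zero_of_residual_zero (lam := lam) (U := U' - C k * U)
    (V := V' - C k * V) (by linear_combination hUV' - C k * hUV)
    (by linear_combination hVU' - C k * hVU)
  exact ⟨k, sub_eq_zero.mp hU0, sub_eq_zero.mp hV0⟩

end Residual

theorem sqrt_div_sq {w : ℝ} (hw : 1 < |w|) : (√(w ^ 2 - 1) / w) ^ 2 = 1 - (w ^ 2)⁻¹ := by
  have hw2 : 1 < w ^ 2 := by rw [← sq_abs]; nlinarith
  rw [div_pow, Real.sq_sqrt (by linarith), sub_div, div_self (by positivity), one_div]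

theorem sqrt_div_bounds {w : ℝ} (hw : 1 < |w|) :
    0 < |√(w ^ 2 - 1) / w| ∧ |√(w ^ 2 - 1) / w| < 1 := by
  have hw2 : 1 < w ^ 2 := by rw [← sq_abs]; nlinarith
  have hw0 : w ≠ 0 := by rintro rfl; norm_num at hw2
  refine ⟨abs_pos.mpr (div_ne_zero (Real.sqrt_pos.mpr (by linarith)).ne' hw0), ?_⟩
  rw [← sq_lt_one_iff_abs_lt_one, sqrt_div_sq hw]
  have : 0 < (w ^ 2)⁻¹ := by positivity
  linarith

theorem sqrt_div_injective {w₁ w₂ : ℝ} (h₁ : 1 < |w₁|) (h₂ : 1 < |w₂|)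
    (h : √(w₁ ^ 2 - 1) / w₁ = √(w₂ ^ 2 - 1) / w₂) : w₁ = w₂ := by
  have hsq : w₁ ^ 2 = w₂ ^ 2 := by
    have := congrArg (· ^ 2) h
    simp only [sqrt_div_sq h₁, sqrt_div_sq h₂] at this
    exact inv_injective (by linarith)
  have hs : √(w₂ ^ 2 - 1) ≠ 0 := by
    have : 1 < w₂ ^ 2 := by rw [← sq_abs]; nlinarith
    exact (Real.sqrt_pos.mpr (by linarith)).ne'
  rw [hsq, div_eq_mul_inv, div_eq_mul_inv] at h
  exact inv_injective (mul_left_cancel₀ hs h)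

theorem exists_sqrt_div_eq {lam : ℝ} (h0 : lam ≠ 0) (h1 : |lam| < 1) :
    ∃ w : ℝ, w ≠ 0 ∧ (1 - lam ^ 2) * w ^ 2 = 1 ∧ lam = √(w ^ 2 - 1) / w := by
  have hpos : 0 < 1 - lam ^ 2 := by
    have := sq_lt_one_iff_abs_lt_one lam |>.mpr h1
    linarith
  set W := (√(1 - lam ^ 2))⁻¹ with hW
  have hW0 : 0 < W := inv_pos.mpr (Real.sqrt_pos.mpr hpos)
  have hWsq : (1 - lam ^ 2) * W ^ 2 = 1 := by
    rw [hW, inv_pow, Real.sq_sqrt hpos.le, mul_inv_cancel₀ hpos.ne']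
  have hs : W ^ 2 - 1 = (lam * W) ^ 2 := by linear_combination hWsq
  rcases lt_or_gt_of_ne h0 with h | h
  · refine ⟨-W, (neg_neg_of_pos hW0).ne, by rw [neg_sq]; exact hWsq, ?_⟩
    rw [neg_sq, hs, Real.sqrt_sq_eq_abs, abs_mul, abs_of_neg h, abs_of_pos hW0]
    field_simp
  · refine ⟨W, hW0.ne', hWsq, ?_⟩
    rw [hs, Real.sqrt_sq_eq_abs, abs_mul, abs_of_pos h, abs_of_pos hW0]
    field_simp

theorem stmt17
    (ζ : ℝ) (hζ : 0 < ζ)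
    (P0 P1 : ℕ → Polynomial ℝ) (lc0 lc1 : ℕ → ℝ)
    (hdeg0 : ∀ n, (P0 n).natDegree = n)
    (hdeg1 : ∀ n, (P1 n).natDegree = n)
    (hlc0 : ∀ n, (P0 n).leadingCoeff = lc0 n)
    (hlc1 : ∀ n, (P1 n).leadingCoeff = lc1 n)
    (hlc0pos : ∀ n, 0 < lc0 n)
    (hlc1pos : ∀ n, 0 < lc1 n)
    (horth0 : ∀ m n, (∫ x in Set.Ioi (1 : ℝ),
        (P0 m).eval x * (P0 n).eval x * wgt 0 ζ x) = if m = n then (1 : ℝ) else 0)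
    (horth1 : ∀ m n, (∫ x in Set.Ioi (1 : ℝ),
        (P1 m).eval x * (P1 n).eval x * wgt 1 ζ x) = if m = n then (1 : ℝ) else 0)
    (z0 z1 : ℕ → ℕ → ℝ)
    (hzfac0 : ∀ n, P0 n = C (lc0 n) * ∏ i ∈ Finset.Icc 1 n, (X - C (z0 n i)))
    (hzfac1 : ∀ n, P1 n = C (lc1 n) * ∏ i ∈ Finset.Icc 1 n, (X - C (z1 n i)))
    (hzgt0 : ∀ n i, 1 ≤ i → i ≤ n → 1 < z0 n i)
    (hzgt1 : ∀ n i, 1 ≤ i → i ≤ n → 1 < z1 n i)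
    (hzmono0 : ∀ n i j, 1 ≤ i → i < j → j ≤ n → z0 n i < z0 n j)
    (hzmono1 : ∀ n i j, 1 ≤ i → i < j → j ≤ n → z1 n i < z1 n j)
    (a0 a1 b0 b1 p q r : ℕ → ℝ)
    (ha0 : ∀ n, a0 n = lc0 n / lc0 (n + 1))
    (ha1 : ∀ n, a1 n = lc1 n / lc1 (n + 1))
    (hb0 : ∀ n, b0 n = ∫ x in Set.Ioi (1 : ℝ), x * ((P0 n).eval x) ^ 2 * wgt 0 ζ x)
    (hb1 : ∀ n, b1 n = ∫ x in Set.Ioi (1 : ℝ), x * ((P1 n).eval x) ^ 2 * wgt 1 ζ x)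
    (hp : ∀ n, p n = lc0 n / lc1 n)
    (hr : ∀ n, r (n + 1) = lc1 n / lc0 (n + 2))
    (hq : ∀ n, q n = ∫ x in Set.Ioi (1 : ℝ),
        (P0 (n + 1)).eval x * (P1 n).eval x * wgt 1 ζ x)
    (N : ℕ)
    (A0 A1 : Matrix (Fin (N + 2) ⊕ Fin (N + 1)) (Fin (N + 2) ⊕ Fin (N + 1)) ℝ)
    (hA0 : A0 = Matrix.fromBlocks (jacobiSq a0 b0 (N + 1)) 0 0 (jacobiSq a1 b1 N))
    (hA1 : A1 = Matrix.fromBlocks 0 (jacobiRect p q r N).transpose (jacobiRect p q r N) 0)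
    (Q : Polynomial ℝ)
    (hQ : Q = P0 (N + 2) * (P1 (N + 1)).comp (-X) + (P0 (N + 2)).comp (-X) * P1 (N + 1))
    (zz : ℝ) (hzz : Q.eval zz = 0)
    (lamhat : ℝ) (hlam : lamhat = Real.sqrt (zz ^ 2 - 1) / zz)
    (uv : Fin (N + 2) → ℝ)
    (huv : ∀ k : Fin (N + 2), uv k =
      (P0 (k : ℕ)).eval zz * (P1 (N + 1)).eval (-zz)
        + (P0 (k : ℕ)).eval (-zz) * (P1 (N + 1)).eval zz)
    (vv : Fin (N + 1) → ℝ)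
    (hvv : ∀ k : Fin (N + 1), vv k = Real.sqrt (zz ^ 2 - 1) *
        ((P1 (k : ℕ)).eval zz * (P1 (N + 1)).eval (-zz)
          - (P1 (k : ℕ)).eval (-zz) * (P1 (N + 1)).eval zz))
    (u0 : Fin (N + 2) → ℝ)
    (hu0 : ∀ k : Fin (N + 2), u0 k =
      (P0 (k : ℕ)).eval 1 * (P0 (N + 2)).eval (-1)
        - (P0 (k : ℕ)).eval (-1) * (P0 (N + 2)).eval 1) :
    (1 < |zz| ∧ 0 < |lamhat| ∧ |lamhat| < 1) ∧
    (Sum.elim uv vv ≠ 0 ∧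
      A1.mulVec (Sum.elim uv vv) = lamhat • A0.mulVec (Sum.elim uv vv) ∧
      lamhat • (jacobiSq a0 b0 (N + 1)).mulVec uv
        = (jacobiRect p q r N).transpose.mulVec vv ∧
      lamhat • (jacobiSq a1 b1 N).mulVec vv = (jacobiRect p q r N).mulVec uv) ∧
    (Sum.elim u0 (fun _ : Fin (N + 1) => (0 : ℝ)) ≠ 0 ∧
      A1.mulVec (Sum.elim u0 (fun _ : Fin (N + 1) => (0 : ℝ))) = 0) ∧
    (∀ lam : ℝ,
      (∃ y : Fin (N + 2) ⊕ Fin (N + 1) → ℝ,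
          y ≠ 0 ∧ A1.mulVec y = lam • A0.mulVec y) ↔
        (lam = 0 ∨ ∃ w : ℝ, Q.eval w = 0 ∧ lam = Real.sqrt (w ^ 2 - 1) / w)) ∧
    (∀ lam : ℝ, ∀ y : Fin (N + 2) ⊕ Fin (N + 1) → ℝ,
      y ≠ 0 → A1.mulVec y = lam • A0.mulVec y → |lam| < 1) ∧
    (∀ lam : ℝ, ∀ y1 y2 : Fin (N + 2) ⊕ Fin (N + 1) → ℝ,
      y1 ≠ 0 → y2 ≠ 0 → A1.mulVec y1 = lam • A0.mulVec y1 →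
        A1.mulVec y2 = lam • A0.mulVec y2 → ∃ cc : ℝ, y2 = cc • y1) ∧
    (∀ w1 w2 : ℝ, Q.eval w1 = 0 → Q.eval w2 = 0 →
      Real.sqrt (w1 ^ 2 - 1) / w1 = Real.sqrt (w2 ^ 2 - 1) / w2 → w1 = w2) := by
  have hint0 := integrableOn_eval_mul_wgt hdeg0 horth0
  have hint1 := integrableOn_eval_mul_wgt hdeg1 horth1
  have hK : besselK 1 ζ ≠ 0 := by
    intro hK
    have := horth0 0 0
    simp [wgt, hK] at this
  set L₀ := wgtFunctional 0 ζ hint0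
  set L₁ := wgtFunctional 1 ζ hint1
  have hL₀ : ∀ R, L₀ R = ∫ x in Set.Ioi (1 : ℝ), R.eval x * wgt 0 ζ x := fun _ => rfl
  have hL₁ : ∀ R, L₁ R = ∫ x in Set.Ioi (1 : ℝ), R.eval x * wgt 1 ζ x := fun _ => rfl
  have h₀ : IsOrthonormalSeq L₀ P0 :=
    ⟨hdeg0, fun m n => by rw [hL₀, ← horth0]; simp only [eval_mul]⟩
  have h₁ : IsOrthonormalSeq L₁ P1 :=
    ⟨hdeg1, fun m n => by rw [hL₁, ← horth1]; simp only [eval_mul]⟩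
  have hL : ∀ R, L₁ R = L₀ ((X ^ 2 - 1) * R) := by
    intro R
    rw [hL₀, hL₁]
    refine setIntegral_congr_fun measurableSet_Ioi fun x hx => ?_
    simp only [eval_mul, eval_sub, eval_pow, eval_X, eval_one]
    rw [wgt_one_eq ζ hx]
    ring
  have hpos : ∀ R : ℝ[X], R ≠ 0 → (∀ x, 1 < x → 0 ≤ R.eval x) → 0 < L₀ R :=
    fun R => wgtFunctional_pos hK hint0
  have hS : ∀ i j, jacobiSq a0 b0 (N + 1) i j = L₀ (X * P0 i * P0 j) :=
    h₀.jacobiSq_eq (fun n => by rw [ha0, hlc0, hlc0])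
      (fun n => by
        rw [hb0, hL₀]
        congr 1
        ext x
        simp only [eval_mul, eval_X]
        ring) _
  have hT : ∀ i j, jacobiSq a1 b1 N i j = L₁ (X * P1 i * P1 j) :=
    h₁.jacobiSq_eq (fun n => by rw [ha1, hlc1, hlc1])
      (fun n => by
        rw [hb1, hL₁]
        congr 1
        ext x
        simp only [eval_mul, eval_X]
        ring) _
  have hB : ∀ i j, jacobiRect p q r N i j = L₁ (P0 j * P1 i) :=
    jacobiRect_eq h₀ h₁ hL (fun n => by rw [hp, hlc0, hlc1])
      (fun n => by rw [hq, hL₁]; simp only [eval_mul])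
      (fun n => by rw [hr, hlc0, hlc1]) _
  have hP0 : ∀ n {x : ℝ}, x ≤ 1 → (P0 n).eval x ≠ 0 := fun n _ =>
    eval_ne_zero_of_le_one (hlc0pos n) (hzfac0 n) (hzgt0 n)
  have hP1 : ∀ n {x : ℝ}, x ≤ 1 → (P1 n).eval x ≠ 0 := fun n _ =>
    eval_ne_zero_of_le_one (hlc1pos n) (hzfac1 n) (hzgt1 n)
  have hQeval : ∀ w, Q.eval w = (P0 (N + 2)).eval w * (P1 (N + 1)).eval (-w)
      + (P0 (N + 2)).eval (-w) * (P1 (N + 1)).eval w := by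
    intro w
    rw [hQ]
    simp
  have hQabs : ∀ w, Q.eval w = 0 → 1 < |w| := by
    intro w hw
    by_contra! hle
    obtain ⟨hw1, hw2⟩ := abs_le.mp hle
    have e1 := neg_one_pow_mul_eval_pos (hlc0pos (N + 2)) (hzfac0 _) (hzgt0 _) hw2
    have e2 := neg_one_pow_mul_eval_pos (hlc0pos (N + 2)) (hzfac0 _) (hzgt0 _)
      (neg_le.mpr hw1)
    have e3 := neg_one_pow_mul_eval_pos (hlc1pos (N + 1)) (hzfac1 _) (hzgt1 _) hw2
    have e4 := neg_one_pow_mul_eval_pos (hlc1pos (N + 1)) (hzfac1 _) (hzgt1 _)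
      (neg_le.mpr hw1)
    have e5 := add_pos (mul_pos e1 e4) (mul_pos e2 e3)
    rw [hQeval] at hw
    refine e5.ne' ?_
    linear_combination (-1) ^ (N + 2) * (-1) ^ (N + 1) * hw
  have hP0zero : ∀ x, (P0 0).eval x = lc0 0 := by
    intro x
    rw [hzfac0]
    simp
  have hP1zero : ∀ x, (P1 0).eval x = lc1 0 := by
    intro x
    rw [hzfac1]
    simp
  have hexplicit : ∀ w, Q.eval w = 0 → ∀ (u : Fin (N + 2) → ℝ) (v : Fin (N + 1) → ℝ),
      (∀ k : Fin (N + 2), u k = (P0 (k : ℕ)).eval w * (P1 (N + 1)).eval (-w)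
        + (P0 (k : ℕ)).eval (-w) * (P1 (N + 1)).eval w) →
      (∀ k : Fin (N + 1), v k = Real.sqrt (w ^ 2 - 1) *
        ((P1 (k : ℕ)).eval w * (P1 (N + 1)).eval (-w)
          - (P1 (k : ℕ)).eval (-w) * (P1 (N + 1)).eval w)) →
      Sum.elim u v ≠ 0 ∧
      (√(w ^ 2 - 1) / w) • (jacobiSq a0 b0 (N + 1)).mulVec u
        = (jacobiRect p q r N).transpose.mulVec v ∧
      (√(w ^ 2 - 1) / w) • (jacobiSq a1 b1 N).mulVec v = (jacobiRect p q r N).mulVec u := by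
    intro w hw u v hu hv
    have hw1 := hQabs w hw
    have hw2 : 1 < w ^ 2 := by rw [← sq_abs]; nlinarith
    have hw0 : w ≠ 0 := by rintro rfl; norm_num at hw2
    refine ⟨fun h => ?_, explicit_eigenvector h₀ h₁ hL hS hT hB
      (Real.sq_sqrt (by linarith)) (div_mul_cancel₀ _ hw0) (by rw [← hQeval, hw]) hu hv⟩
    have hu0 := congrFun h (Sum.inl 0)
    have hv0 := congrFun h (Sum.inr 0)
    simp only [Sum.elim_inl, Sum.elim_inr, Pi.zero_apply, hu, hv, Fin.val_zero,
      hP0zero, hP1zero] at hu0 hv0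
    have hu1 : (P1 (N + 1)).eval (-w) + (P1 (N + 1)).eval w = 0 := by
      refine (mul_eq_zero.mp ?_).resolve_left (hlc0pos 0).ne'
      linear_combination hu0
    have hv1 : (P1 (N + 1)).eval (-w) - (P1 (N + 1)).eval w = 0 := by
      refine (mul_eq_zero.mp ?_).resolve_left (hlc1pos 0).ne'
      refine (mul_eq_zero.mp ?_).resolve_left
        (Real.sqrt_pos.mpr (show 0 < w ^ 2 - 1 by linarith)).ne'
      linear_combination hv0
    rcases lt_abs.mp hw1 with h' | h'
    · exact hP1 (N + 1) (x := -w) (by linarith) (by linarith)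
    · exact hP1 (N + 1) (x := w) (by linarith) (by linarith)
  have hiff : ∀ (lam : ℝ) (u : Fin (N + 2) → ℝ) (v : Fin (N + 1) → ℝ),
      A1.mulVec (Sum.elim u v) = lam • A0.mulVec (Sum.elim u v) ↔
        lam • (jacobiSq a0 b0 (N + 1)).mulVec u = (jacobiRect p q r N).transpose.mulVec v ∧
        lam • (jacobiSq a1 b1 N).mulVec v = (jacobiRect p q r N).mulVec u := by
    intro lam u v
    rw [hA0, hA1]
    exact fromBlocks_mulVec_eq_smul_iff _ _ _ _ _ _
  have hresidual : ∀ (lam : ℝ) (y : Fin (N + 2) ⊕ Fin (N + 1) → ℝ),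
      A1.mulVec y = lam • A0.mulVec y → ∃ c d : ℝ,
        C lam * (X * combination P0 (y ∘ Sum.inl)) - (X ^ 2 - 1) * combination P1 (y ∘ Sum.inr)
          = C c * P0 (N + 2) ∧
        C lam * (X * combination P1 (y ∘ Sum.inr)) - combination P0 (y ∘ Sum.inl)
          = C d * P1 (N + 1) := by
    intro lam y hy
    rw [← Sum.elim_comp_inl_inr y, hiff] at hy
    exact exists_residual h₀ h₁ hL hS hT hB hy.1 hy.2
  have hpolys_ne : ∀ y : Fin (N + 2) ⊕ Fin (N + 1) → ℝ, y ≠ 0 →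
      ¬(combination P0 (y ∘ Sum.inl) = 0 ∧ combination P1 (y ∘ Sum.inr) = 0) := by
    rintro y hy ⟨hu, hv⟩
    rw [← combination_zero P0 (N + 2)] at hu
    rw [← combination_zero P1 (N + 1)] at hv
    refine hy ?_
    rw [← Sum.elim_comp_inl_inr y, h₀.combination_injective hu, h₁.combination_injective hv]
    exact Sum.elim_zero_zero
  have hlt : ∀ (lam : ℝ) (y : Fin (N + 2) ⊕ Fin (N + 1) → ℝ),
      y ≠ 0 → A1.mulVec y = lam • A0.mulVec y → |lam| < 1 := by
    intro lam y hy hyeq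
    obtain ⟨c, d, hUV, hVU⟩ := hresidual lam y hyeq
    by_contra! hlam1
    exact hpolys_ne y hy (eq_zero_of_residual_of_one_le_abs h₀ h₁ hL hpos
      (h₀.degree_combination_lt _) (h₁.degree_combination_lt _) hUV hVU hlam1)
  have hkernel : Sum.elim u0 (fun _ : Fin (N + 1) => (0 : ℝ)) ≠ 0 ∧
      A1.mulVec (Sum.elim u0 (fun _ : Fin (N + 1) => (0 : ℝ))) = 0 := by
    constructor
    · intro h
      have h0 := congrFun h (Sum.inl 0)
      simp only [Sum.elim_inl, Pi.zero_apply, hu0, Fin.val_zero, hP0zero, ← mul_sub] at h0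
      have h1 := (mul_eq_zero.mp h0).resolve_left (hlc0pos 0).ne'
      exact eval_one_ne_eval_neg_one (by omega) (hlc0pos (N + 2)) (hzfac0 _) (hzgt0 _)
        (sub_eq_zero.mp h1).symm
    · have hk := explicit_kernel_vector h₀ h₁ hL hB hu0
      have := (hiff 0 u0 (fun _ => 0)).mpr ⟨by
        rw [zero_smul]
        exact (Matrix.mulVec_zero _).symm, by rw [zero_smul, hk]⟩
      rwa [zero_smul] at this
  have hzz1 := hQabs zz hzz
  have hmain := hexplicit zz hzz uv vv huv hvv
  rw [← hlam] at hmain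
  refine ⟨⟨hzz1, hlam ▸ sqrt_div_bounds hzz1⟩,
    ⟨hmain.1, (hiff _ _ _).mpr hmain.2, hmain.2⟩, hkernel, fun lam => ⟨?_, ?_⟩, hlt, ?_,
    fun w1 w2 h1 h2 => sqrt_div_injective (hQabs w1 h1) (hQabs w2 h2)⟩
  · rintro ⟨y, hy, hyeq⟩
    refine or_iff_not_imp_left.mpr fun hlam0 => ?_
    obtain ⟨w, hw0, hw, hwlam⟩ := exists_sqrt_div_eq hlam0 (hlt lam y hy hyeq)
    obtain ⟨c, d, hUV, hVU⟩ := hresidual lam y hyeq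
    refine ⟨w, ?_, hwlam⟩
    rw [hQeval]
    rcases le_total 0 w with h | h
    · exact eval_eq_zero_of_residual hUV hVU (hpolys_ne y hy) hlam0 hw0 hw
        (hP1 _ (by linarith))
    · have := eval_eq_zero_of_residual hUV hVU (hpolys_ne y hy) hlam0 (neg_ne_zero.mpr hw0)
        (by rw [neg_sq]; exact hw) (by rw [neg_neg]; exact hP1 _ (by linarith))
      rw [neg_neg] at this
      linarith
  · rintro (rfl | ⟨w, hw, rfl⟩)
    · exact ⟨_, hkernel.1, by rw [hkernel.2, zero_smul]⟩
    · have := hexplicit w hw _ _ (fun _ => rfl) (fun _ => rfl)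
      exact ⟨_, this.1, (hiff _ _ _).mpr this.2⟩
  · intro lam y1 y2 hy1 _ hy1eq hy2eq
    obtain ⟨c, d, hUV, hVU⟩ := hresidual lam y1 hy1eq
    obtain ⟨c', d', hUV', hVU'⟩ := hresidual lam y2 hy2eq
    have hsq : 0 < 1 - lam ^ 2 := by
      have := sq_lt_one_iff_abs_lt_one lam |>.mpr (hlt lam y1 hy1 hy1eq)
      linarith
    obtain ⟨k, hU, hV⟩ := residual_proportional hUV hVU hUV' hVU' (hpolys_ne y1 hy1)
      (w := -(√(1 - lam ^ 2))⁻¹)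
      (by rw [neg_sq, inv_pow, Real.sq_sqrt hsq.le, mul_inv_cancel₀ hsq.ne'])
      (hP0 _ (by
        have := inv_nonneg.mpr (Real.sqrt_nonneg (1 - lam ^ 2))
        linarith))
    rw [← combination_smul] at hU hV
    refine ⟨k, funext ?_⟩
    rintro (i | i)
    · exact congrFun (h₀.combination_injective hU) i
    · exact congrFun (h₁.combination_injective hV) i
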